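/- arXiv:0803.2204 — 2 statements merged into one kernel-verified Lean document; each statement's English description precedes it below -/
import Mathlib

section
/- Let g ≥ 0 and a, b ∈ ℤ. In the one-variable case n = 1, the coefficient of y^{2g−4+a+b} x^{g+1} in L_g^{a,b}(y,x) equals (−1)^b (2g−2+a+b)/(4^g (2g+1)!!). -/
open MvPolynomial Finset

noncomputable section

/-- The polynomial ring `ℚ[x_1,…,x_n]`. -/
abbrev R (n : ℕ) : Type := MvPolynomial (Fin n) ℚ

/-- The field of rational functions `ℚ(x_1,…,x_n)`. -/
abbrev K (n : ℕ) : Type := FractionRing (R n)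

/-- `x_1 + ⋯ + x_n` as an element of `K n`. -/
def SX (n : ℕ) : K n := algebraMap (R n) (K n) (∑ j, X j)

/-- `x_1^3 + ⋯ + x_n^3` as an element of `K n`. -/
def SX3 (n : ℕ) : K n := algebraMap (R n) (K n) (∑ j, (X j)^3)

/-- `Δ(x_1,…,x_n) = ((Σ x_j)^3 − Σ x_j^3)/3`. -/
def Dlt (n : ℕ) : K n := ((SX n)^3 - SX3 n) / 3

/-- The ring homomorphism `ℚ[x_1,…,x_{|I|}] → ℚ(x_1,…,x_n)` substituting the variables
of the subset `I` (in increasing order). -/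
def embRH {n : ℕ} (I : Finset (Fin n)) : R I.card →+* K n :=
  (algebraMap (R n) (K n)).comp
    (MvPolynomial.rename (fun i : Fin I.card => ((I.orderIsoOfFin rfl) i : Fin n))).toRingHom

lemma embRH_inj {n : ℕ} (I : Finset (Fin n)) : Function.Injective (embRH I) := by
  have h1 : Function.Injective (fun i : Fin I.card => ((I.orderIsoOfFin rfl) i : Fin n)) := by
    intro i j hij
    exact (I.orderIsoOfFin rfl).injective (Subtype.val_injective hij)
  have h2 := (IsFractionRing.injective (R n) (K n)).comp (MvPolynomial.rename_injective _ h1)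
  simpa [embRH, RingHom.coe_comp] using h2

/-- The field embedding `ℚ(x_1,…,x_{|I|}) → ℚ(x_1,…,x_n)` substituting the variables
of the subset `I` (in increasing order).  Used for expressions like `G_{r'}(x_I)`. -/
def emb {n : ℕ} (I : Finset (Fin n)) : K I.card →+* K n :=
  IsFractionRing.lift (embRH_inj I)

/-- The normalized `n`-point functions `G_g(x_1,…,x_n)`, defined with a fuel parameter
(first argument) for structural recursion; for `fuel ≥ n` this computes the recursively
defined normalized `n`-point function:  `G_0(x) = x^{-2}`, `G_g(x) = 0` for `g ≥ 1`, and
for `n ≥ 2`,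
`G_g = Σ_{r+s=g} ((2r+n−3)!!/(4^s(2r+2s+n−1)!!)) P_r Δ^s` where
`P_r = (1/(2Σx_j)) Σ_{I⊔J={1..n}, I,J≠∅} (Σ_I x)²(Σ_J x)² Σ_{r'≤r} G_{r'}(x_I)G_{r−r'}(x_J)`. -/
def Gf : (fuel : ℕ) → (n : ℕ) → ℕ → K n
  | _, 0, _ => 0
  | _, 1, 0 => (algebraMap (R 1) (K 1) (X 0)) ^ (-2 : ℤ)
  | _, 1, _+1 => 0
  | 0, _+2, _ => 0
  | fuel+1, n+2, g =>
      ∑ s ∈ Finset.range (g+1),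
        (((Nat.doubleFactorial (2*(g-s)+(n+2)-3) : ℚ) /
          (4^s * (Nat.doubleFactorial (2*g+(n+2)-1) : ℚ))) : K (n+2)) *
        ((2 * SX (n+2))⁻¹ *
          ∑ I : Finset (Fin (n+2)),
            if I ≠ ∅ ∧ I ≠ univ then
              (algebraMap (R (n+2)) (K (n+2)) (∑ i ∈ I, X i))^2 *
              (algebraMap (R (n+2)) (K (n+2)) (∑ i ∈ Iᶜ, X i))^2 *
              ∑ r' ∈ Finset.range ((g-s)+1),
                emb I (Gf fuel I.card r') * emb Iᶜ (Gf fuel Iᶜ.card ((g-s) - r'))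
            else 0) *
        (Dlt (n+2))^s

/-- The normalized `n`-point function `G_g(x_1,…,x_n)` as an element of `ℚ(x_1,…,x_n)`. -/
def Gnpt (n g : ℕ) : K n := Gf n n g

/-- `P_r(x_1,…,x_n)`. -/
def Ppoly (n r : ℕ) : K n :=
  (2 * SX n)⁻¹ *
    ∑ I : Finset (Fin n),
      if I ≠ ∅ ∧ I ≠ univ then
        (algebraMap (R n) (K n) (∑ i ∈ I, X i))^2 *
        (algebraMap (R n) (K n) (∑ i ∈ Iᶜ, X i))^2 *
        ∑ r' ∈ Finset.range (r+1), emb I (Gnpt I.card r') * emb Iᶜ (Gnpt Iᶜ.card (r - r'))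
      else 0

/-- The `n`-point function `F_g(x_1,…,x_n) = Σ_{h+d=g} (1/d!)((Σx_j^3)/24)^d G_h(x_1,…,x_n)`. -/
def Fnpt (n g : ℕ) : K n :=
  ∑ d ∈ Finset.range (g+1),
    ((1 / (Nat.factorial d : ℚ)) : K n) * (SX3 n / 24)^d * Gnpt n (g-d)

open Classical in
/-- The coefficient of the monomial `Π x_j^{d_j}` of an element of `ℚ(x_1,…,x_n)` which is
a polynomial (junk value `0` otherwise). -/
def coeffK {n : ℕ} (f : K n) (d : Fin n → ℕ) : ℚ :=
  if h : ∃ p : R n, algebraMap (R n) (K n) p = f then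
    MvPolynomial.coeff (Finsupp.equivFunOnFinite.symm d) h.choose
  else 0

/-- The intersection index `⟨τ_{d_1} ⋯ τ_{d_n}⟩_g`, i.e. the coefficient of `Π x_j^{d_j}`
in `F_g(x_1,…,x_n)`.  For `(g,n) = (0,1), (0,2)` and nonnegative `d_j` the value is `0`
(the conventional values `⟨τ_{-2}⟩_0 = 1`, `⟨τ_k τ_{-1-k}⟩_0 = (-1)^k` have a negative index). -/
def bracket (g : ℕ) {n : ℕ} (d : Fin n → ℕ) : ℚ :=
  if g = 0 ∧ n ≤ 2 then 0 else coeffK (Fnpt n g) d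

/-- `⟨τ_j Π_{i ∈ I} τ_{d_i}⟩_g` for a subset `I ⊆ {1,…,n}`. -/
def bracketI (g : ℕ) {n : ℕ} (j : ℕ) (I : Finset (Fin n)) (d : Fin n → ℕ) : ℚ :=
  bracket g (Fin.cons j (fun i : Fin I.card => d ((I.orderIsoOfFin rfl) i)))


/-! ### Laurent expansions in `y` (formal series in `ℚ[x_1,…,x_n][[y,y⁻¹]]` of bounded
`y`-degree, realized as Hahn/Laurent series in the variable `t = y⁻¹`, so that the
coefficient of `y^k` is the Hahn coefficient at `-k`). -/

/-- Laurent series in `t = y⁻¹` with coefficients in `ℚ[x_1,…,x_n]`. -/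
abbrev Lau (n : ℕ) : Type := LaurentSeries (R n)

/-- The generalized binomial coefficient `C(p,k) = p(p−1)⋯(p−k+1)/k!` for `p : ℤ`, `k : ℕ`. -/
def binomZ (p : ℤ) (k : ℕ) : ℚ := (∏ i ∈ Finset.range k, ((p : ℚ) - i)) / (Nat.factorial k)

/-- The expansion of `(y + c)^m = Σ_{k≥0} C(m,k) c^k y^{m−k}` as a Laurent series
in `t = y⁻¹` (for `m ≥ 0` this is the usual binomial expansion of the polynomial). -/
def yExpAdd {n : ℕ} (c : R n) (m : ℤ) : Lau n :=
  (HahnSeries.single (-m) (1 : R n)) *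
    HahnSeries.ofPowerSeries ℤ (R n)
      (PowerSeries.mk fun k => MvPolynomial.C (binomZ m k) * c^k)

/-- The expansion of `(±y + c)^m`, where the sign is `+` if `σ = true` and `−` otherwise;
it is computed as `(±1)^m (y ± c)^m`. -/
def LExp {n : ℕ} (σ : Bool) (c : R n) (m : ℤ) : Lau n :=
  (if σ then 1 else if Even m then 1 else -1 : Lau n) *
    yExpAdd ((if σ then 1 else -1 : R n) * c) m

open Classical in
/-- The polynomial representing an element of `ℚ(x_1,…,x_n)` lying in `ℚ[x_1,…,x_n]`
(junk value `0` otherwise). -/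
def polyOf {n : ℕ} (f : K n) : R n :=
  if h : ∃ p : R n, algebraMap (R n) (K n) p = f then h.choose else 0

/-- `±y` as a Laurent series in `t = y⁻¹`. -/
def yLau (n : ℕ) (σ : Bool) : Lau n :=
  (if σ then 1 else -1 : Lau n) * HahnSeries.single (-1 : ℤ) (1 : R n)

/-- The expansion of `F_g(±y, x_I)` as a Laurent series in `t = y⁻¹` with coefficients in
`ℚ[x_1,…,x_n]`: for `(g,|I|+1) = (0,1)` it is `(±y)^{-2} = y^{-2}`, for `(g,|I|+1) = (0,2)`
it is `1/(±y + x_i) = Σ_{k≥0} (−1)^k x_i^k (±y)^{−k−1}`, and otherwise it is obtained by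
substituting `±y` and the variables of `I` into the polynomial `F_g`. -/
def FExp {n : ℕ} (σ : Bool) (g : ℕ) (I : Finset (Fin n)) : Lau n :=
  if g = 0 ∧ I.card = 0 then HahnSeries.single (2 : ℤ) (1 : R n)
  else if g = 0 ∧ I.card = 1 then LExp σ (∑ i ∈ I, X i) (-1)
  else
    MvPolynomial.eval₂ ((HahnSeries.C).comp (algebraMap ℚ (R n)))
      (Fin.cons (yLau n σ)
        (fun i : Fin I.card => HahnSeries.C (X ((I.orderIsoOfFin rfl) i : Fin n))))
      (polyOf (Fnpt (I.card + 1) g))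

/-- `L_g^{a,b}(y, x_1,…,x_n) = Σ_{g'=0}^{g} Σ_{I⊔J={1,…,n}} (y+Σ_I x)^a (−y+Σ_J x)^b
F_{g'}(y,x_I) F_{g−g'}(−y,x_J)` as a Laurent series in `t = y⁻¹`. -/
def LL (g n : ℕ) (a b : ℤ) : Lau n :=
  ∑ gp ∈ Finset.range (g+1), ∑ I : Finset (Fin n),
    LExp true (∑ i ∈ I, X i) a * LExp false (∑ i ∈ Iᶜ, X i) b *
      FExp true gp I * FExp false (g - gp) Iᶜ

/-- The coefficient of `y^k Π_j x_j^{d_j}` in a Laurent series in `t = y⁻¹` with coefficients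
in `ℚ[x_1,…,x_n]`. -/
def coeffL {n : ℕ} (f : Lau n) (k : ℤ) (d : Fin n → ℕ) : ℚ :=
  MvPolynomial.coeff (Finsupp.equivFunOnFinite.symm d) (f.coeff (-k))

/-- The index of the variable `z_i` among the `a + b + n` variables `z, w, x`. -/
def zIdx (a b n : ℕ) (i : Fin a) : Fin (a+b+n) := ⟨i.1, by have := i.2; omega⟩

/-- The index of the variable `w_i` among the `a + b + n` variables `z, w, x`. -/
def wIdx (a b n : ℕ) (i : Fin b) : Fin (a+b+n) := ⟨a + i.1, by have := i.2; omega⟩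

/-- The index of the variable `x_i` among the `a + b + n` variables `z, w, x`. -/
def xIdx (a b n : ℕ) (i : Fin n) : Fin (a+b+n) := ⟨a + b + i.1, by have := i.2; omega⟩

/-- `L_g(y; z_1,…,z_a; w_1,…,w_b; x_1,…,x_n)
 = Σ_{g'=0}^{g} Σ_{I⊔J={1,…,n}} F_{g'}(y, z, x_I) F_{g−g'}(−y, w, x_J)`,
as a Laurent series in `t = y⁻¹` with coefficients in `ℚ[z,w,x]`. -/
def LLm (g n a b : ℕ) : Lau (a+b+n) :=
  ∑ gp ∈ Finset.range (g+1), ∑ I : Finset (Fin n),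
    FExp true gp ((univ.image (zIdx a b n)) ∪ I.image (xIdx a b n)) *
    FExp false (g - gp) ((univ.image (wIdx a b n)) ∪ Iᶜ.image (xIdx a b n))

/-- The exponent vector of the monomial `Π z_j^{r_j} Π w_j^{s_j} Π x_j^{d_j}`. -/
def expVec (a b n : ℕ) (r : Fin a → ℕ) (s : Fin b → ℕ) (d : Fin n → ℕ) :
    Fin (a+b+n) → ℕ :=
  fun v =>
    if h : v.1 < a then r ⟨v.1, h⟩
    else if h2 : v.1 < a + b then s ⟨v.1 - a, by omega⟩
    else d ⟨v.1 - (a+b), by have := v.2; omega⟩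


/-- The sign `±1` attached to a Boolean: `+` for `true` and `−` for `false`. -/
def sgnB (σ : Bool) : ℚ := if σ then 1 else -1

lemma sgnB_ne_zero (σ : Bool) : sgnB σ ≠ 0 := by cases σ <;> simp [sgnB]

lemma binomZ_eq_choose (p : ℤ) (k : ℕ) : binomZ p k = Ring.choose (p : ℚ) k := by
  rw [binomZ, Ring.choose_eq_smul, ← Polynomial.aeval_eq_smeval, ← Polynomial.eval_map_algebraMap,
    descPochhammer_map, descPochhammer_eval_eq_prod_range, smul_eq_mul, div_eq_inv_mul]

lemma mk_binomZ_eq_rescale {n : ℕ} (c : R n) (m : ℤ) :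
    (PowerSeries.mk fun k => MvPolynomial.C (binomZ m k) * c ^ k) =
      PowerSeries.rescale c (PowerSeries.binomialSeries (R n) (m : ℚ)) := by
  ext1 k
  rw [PowerSeries.coeff_mk, PowerSeries.coeff_rescale, PowerSeries.binomialSeries_coeff,
    binomZ_eq_choose, MvPolynomial.smul_eq_C_mul, mul_one, mul_comm]

lemma yExpAdd_add {n : ℕ} (c : R n) (m m' : ℤ) :
    yExpAdd c (m + m') = yExpAdd c m * yExpAdd c m' := by
  rw [yExpAdd, yExpAdd, yExpAdd, mk_binomZ_eq_rescale, mk_binomZ_eq_rescale,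
    mk_binomZ_eq_rescale, Int.cast_add, PowerSeries.binomialSeries_add, map_mul, map_mul,
    mul_mul_mul_comm, HahnSeries.single_mul_single, one_mul, neg_add]

lemma yExpAdd_zero {n : ℕ} (c : R n) : yExpAdd c 0 = 1 := by
  rw [yExpAdd, mk_binomZ_eq_rescale, Int.cast_zero, PowerSeries.binomialSeries_zero, RingHom.map_one,
    RingHom.map_one, mul_one, neg_zero]
  rfl

lemma yExpAdd_one {n : ℕ} (c : R n) :
    yExpAdd c 1 = HahnSeries.single (-1 : ℤ) (1 : R n) + HahnSeries.C c := by
  have h1 : PowerSeries.binomialSeries (R n) (1 : ℚ) = 1 + PowerSeries.X := by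
    simpa using PowerSeries.binomialSeries_nat (R := ℚ) (A := R n) 1
  rw [yExpAdd, mk_binomZ_eq_rescale, Int.cast_one, h1, map_add, RingHom.map_one,
    PowerSeries.rescale_X, map_add, RingHom.map_one, map_mul, HahnSeries.ofPowerSeries_X,
    HahnSeries.ofPowerSeries_C, mul_add, mul_one, mul_left_comm, HahnSeries.single_mul_single,
    one_mul, neg_add_cancel]
  exact congrArg _ (mul_one _)

lemma yExpAdd_of_zero {n : ℕ} (m : ℤ) : yExpAdd (0 : R n) m = HahnSeries.single (-m) 1 := by
  rw [yExpAdd, mk_binomZ_eq_rescale, PowerSeries.rescale_zero_apply,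
    PowerSeries.binomialSeries_constantCoeff, RingHom.map_one, RingHom.map_one, mul_one]

lemma coeff_yExpAdd {n : ℕ} (c : R n) (m : ℤ) (k : ℕ) :
    (yExpAdd c m).coeff (k - m) = MvPolynomial.C (binomZ m k) * c ^ k := by
  rw [yExpAdd, sub_eq_add_neg, HahnSeries.coeff_single_mul_add, one_mul,
    HahnSeries.ofPowerSeries_apply_coeff, PowerSeries.coeff_mk]

lemma LExp_eq {n : ℕ} (σ : Bool) (c : R n) (m : ℤ) :
    LExp σ c m = HahnSeries.C (MvPolynomial.C (sgnB σ ^ m)) *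
      yExpAdd (MvPolynomial.C (sgnB σ) * c) m := by
  rw [LExp]
  congr 1
  · cases σ
    · by_cases h : Even m
      · simp [sgnB, h, h.neg_one_zpow]
      · rw [sgnB, if_neg Bool.false_ne_true, if_neg Bool.false_ne_true, if_neg h,
          (Int.not_even_iff_odd.mp h).neg_one_zpow, map_neg, map_one, map_neg, map_one]
    · simp [sgnB]
  · cases σ <;> simp [sgnB]

lemma yLau_eq (n : ℕ) (σ : Bool) :
    yLau n σ = HahnSeries.C (MvPolynomial.C (sgnB σ)) * HahnSeries.single (-1 : ℤ) (1 : R n) := by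
  rw [yLau]
  congr 1
  cases σ
  · rw [sgnB, if_neg (by simp), if_neg (by simp), map_neg, map_one, map_neg, map_one]
  · simp [sgnB]

lemma LExp_add {n : ℕ} (σ : Bool) (c : R n) (m m' : ℤ) :
    LExp σ c (m + m') = LExp σ c m * LExp σ c m' := by
  rw [LExp_eq, LExp_eq, LExp_eq, yExpAdd_add, zpow_add₀ (sgnB_ne_zero σ), map_mul, map_mul,
    mul_mul_mul_comm]

lemma LExp_zero {n : ℕ} (σ : Bool) (c : R n) : LExp σ c 0 = 1 := by
  rw [LExp_eq, yExpAdd_zero, zpow_zero, map_one, map_one, mul_one]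

lemma LExp_one {n : ℕ} (σ : Bool) (c : R n) : LExp σ c 1 = yLau n σ + HahnSeries.C c := by
  rw [LExp_eq, yExpAdd_one, yLau_eq, zpow_one, mul_add, ← map_mul, ← mul_assoc, ← map_mul]
  congr 2
  cases σ <;> simp [sgnB]

lemma LExp_one_pow {n : ℕ} (σ : Bool) (c : R n) (k : ℕ) :
    LExp σ c 1 ^ k = LExp σ c k := by
  induction k with
  | zero => rw [pow_zero, Nat.cast_zero, LExp_zero]
  | succ k ih => rw [pow_succ, ih, ← LExp_add, Nat.cast_succ]

lemma LExp_of_zero {n : ℕ} (σ : Bool) (m : ℤ) :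
    LExp σ (0 : R n) m = HahnSeries.C (MvPolynomial.C (sgnB σ ^ m)) *
      HahnSeries.single (-m) (1 : R n) := by
  rw [LExp_eq, mul_zero, yExpAdd_of_zero]

lemma coeff_LExp {n : ℕ} (σ : Bool) (c : R n) (m : ℤ) (k : ℕ) :
    (LExp σ c m).coeff (k - m) =
      MvPolynomial.C (sgnB σ ^ (m + k) * binomZ m k) * c ^ k := by
  rw [LExp_eq, HahnSeries.C_mul_eq_smul, HahnSeries.coeff_smul, coeff_yExpAdd,
    zpow_add₀ (sgnB_ne_zero σ), zpow_natCast, smul_eq_mul, mul_pow, map_mul, map_mul, map_pow]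
  ring

lemma emb_algebraMap {n : ℕ} (I : Finset (Fin n)) (p : R I.card) :
    emb I (algebraMap (R I.card) (K I.card) p) = embRH I p :=
  IsFractionRing.lift_algebraMap (embRH_inj I) p

lemma emb_Gf_singleton_zero {n : ℕ} (fuel : ℕ) (i : Fin n) :
    emb {i} (Gf fuel ({i} : Finset (Fin n)).card 0) =
      (algebraMap (R n) (K n) (X i)) ^ (-2 : ℤ) := by
  have h : Gf fuel ({i} : Finset (Fin n)).card 0 =
      (algebraMap (R ({i} : Finset (Fin n)).card) (K ({i} : Finset (Fin n)).card)
        (X ⟨0, by simp⟩)) ^ (-2 : ℤ) := by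
    change Gf fuel 1 0 = _
    rw [Gf]
    rfl
  rw [h, map_zpow₀, emb_algebraMap]
  congr 1
  have h2 : ∀ k : Fin ({i} : Finset (Fin n)).card,
      (((({i} : Finset (Fin n)).orderIsoOfFin rfl) k : ({i} : Finset (Fin n))) : Fin n) = i :=
    fun k => Finset.mem_singleton.mp (Subtype.property _)
  simp [embRH, h2]

lemma emb_Gf_singleton_succ {n : ℕ} (fuel : ℕ) (i : Fin n) (r : ℕ) :
    emb {i} (Gf fuel ({i} : Finset (Fin n)).card (r + 1)) = 0 := by
  have h : Gf fuel ({i} : Finset (Fin n)).card (r + 1) = 0 := by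
    change Gf fuel 1 (r + 1) = _
    rw [Gf]
    rfl
  rw [h, map_zero]

lemma emb_Gf_mul_emb_Gf_singleton {n : ℕ} (fuel : ℕ) (i j : Fin n) (r : ℕ) :
    ((algebraMap (R n) (K n) (X i)) ^ 2 * (algebraMap (R n) (K n) (X j)) ^ 2 *
      ∑ r' ∈ Finset.range (r + 1), emb {i} (Gf fuel ({i} : Finset (Fin n)).card r') *
        emb {j} (Gf fuel ({j} : Finset (Fin n)).card (r - r'))) = if r = 0 then 1 else 0 := by
  have hX : ∀ i : Fin n, algebraMap (R n) (K n) (X i) ≠ 0 := fun i => by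
    simp [X_ne_zero]
  rw [Finset.sum_range_succ', Finset.sum_eq_zero, zero_add]
  · rcases r with _ | r
    · have h1 := hX i
      have h2 := hX j
      rw [if_pos rfl, emb_Gf_singleton_zero, emb_Gf_singleton_zero]
      field_simp
    · rw [Nat.sub_zero, emb_Gf_singleton_succ, mul_zero, mul_zero, if_neg (Nat.succ_ne_zero r)]
  · intro k _
    rw [emb_Gf_singleton_succ, zero_mul]

lemma SX_two : SX 2 = algebraMap (R 2) (K 2) (X 0 + X 1) := by
  rw [SX, Fin.sum_univ_two]

lemma SX_two_ne_zero : SX 2 ≠ 0 := by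
  rw [SX_two, Ne, IsFractionRing.to_map_eq_zero_iff]
  intro h
  have := congrArg (MvPolynomial.eval (fun _ => (1 : ℚ))) h
  norm_num at this

lemma Dlt_two : Dlt 2 = algebraMap (R 2) (K 2) (X 0 * X 1 * (X 0 + X 1)) := by
  rw [Dlt, SX3, SX_two, Fin.sum_univ_two]
  simp only [map_add, map_mul, map_pow]
  ring

lemma SX_mul_Gnpt_two (g : ℕ) :
    SX 2 * Gnpt 2 g = algebraMap (R 2) (K 2)
      (C (1 / (4 ^ g * (Nat.doubleFactorial (2 * g + 1) : ℚ))) *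
        (X 0 * X 1 * (X 0 + X 1)) ^ g) := by
  have hu : (univ : Finset (Finset (Fin 2))) = {∅, {0}, {1}, univ} := by decide
  have h0 : ({0}ᶜ : Finset (Fin 2)) = {1} := by decide
  have h1 : ({1}ᶜ : Finset (Fin 2)) = {0} := by decide
  have hP : ∀ r : ℕ, (∑ I : Finset (Fin 2),
      if I ≠ ∅ ∧ I ≠ univ then
        (algebraMap (R 2) (K 2) (∑ i ∈ I, X i)) ^ 2 *
        (algebraMap (R 2) (K 2) (∑ i ∈ Iᶜ, X i)) ^ 2 *
        ∑ r' ∈ Finset.range (r + 1), emb I (Gf 1 I.card r') * emb Iᶜ (Gf 1 Iᶜ.card (r - r'))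
      else 0) = if r = 0 then 2 else 0 := by
    intro r
    rw [hu, Finset.sum_insert (by decide), Finset.sum_insert (by decide),
      Finset.sum_insert (by decide),
      Finset.sum_singleton _ (univ : Finset (Fin 2)),
      if_neg (fun h : (∅ : Finset (Fin 2)) ≠ ∅ ∧ _ => h.1 rfl),
      if_pos (show ({0} : Finset (Fin 2)) ≠ ∅ ∧ ({0} : Finset (Fin 2)) ≠ univ by decide),
      if_pos (show ({1} : Finset (Fin 2)) ≠ ∅ ∧ ({1} : Finset (Fin 2)) ≠ univ by decide),
      if_neg (fun h : (univ : Finset (Fin 2)) ≠ ∅ ∧ univ ≠ univ => h.2 rfl), h0, h1, Finset.sum_singleton,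
      Finset.sum_singleton, emb_Gf_mul_emb_Gf_singleton, emb_Gf_mul_emb_Gf_singleton]
    split_ifs <;> norm_num
  have h2 := SX_two_ne_zero
  rw [Gnpt, Gf, Finset.sum_eq_single_of_mem g (by simp)]
  · rw [Nat.sub_self, hP, if_pos rfl, map_mul, map_pow, ← Dlt_two, ← algebraMap_eq,
      ← IsScalarTower.algebraMap_apply, eq_ratCast]
    push_cast
    field_simp
    norm_num
  · intro s hs hsg
    have hs' : g - s ≠ 0 := by
      have := Finset.mem_range.mp hs
      omega
    rw [hP, if_neg hs', mul_zero, mul_zero, zero_mul]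

/-- `(x_1 + x_2) F_g(x_1, x_2)` as a polynomial. -/
def twoPointNumerator (g : ℕ) : R 2 :=
  ∑ d ∈ Finset.range (g + 1), C (1 / (Nat.factorial d : ℚ)) *
    (C (1 / 24) * (X 0 ^ 3 + X 1 ^ 3)) ^ d *
    (C (1 / (4 ^ (g - d) * (Nat.doubleFactorial (2 * (g - d) + 1) : ℚ))) *
      (X 0 * X 1 * (X 0 + X 1)) ^ (g - d))

lemma SX_mul_Fnpt_two (g : ℕ) :
    SX 2 * Fnpt 2 g = algebraMap (R 2) (K 2) (twoPointNumerator g) := by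
  rw [Fnpt, twoPointNumerator, map_sum, Finset.mul_sum]
  refine Finset.sum_congr rfl fun d _ => ?_
  rw [mul_left_comm, SX_mul_Gnpt_two, map_mul (algebraMap (R 2) (K 2)) (_ * _)]
  congr 1
  rw [SX3, Fin.sum_univ_two, map_mul, map_pow, map_mul (algebraMap (R 2) (K 2)) (C (1 / 24)),
    ← algebraMap_eq, ← IsScalarTower.algebraMap_apply, ← IsScalarTower.algebraMap_apply,
    eq_ratCast, eq_ratCast]
  push_cast
  congr 2
  ring

lemma polyOf_algebraMap {n : ℕ} (p : R n) : polyOf (algebraMap (R n) (K n) p) = p := by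
  have h : ∃ q : R n, algebraMap (R n) (K n) q = algebraMap (R n) (K n) p := ⟨p, rfl⟩
  rw [polyOf, dif_pos h]
  exact IsFractionRing.injective (R n) (K n) h.choose_spec

lemma mul_polyOf_Fnpt_two {g : ℕ} (hg : g ≠ 0) :
    (X 0 + X 1) * polyOf (Fnpt 2 g) = twoPointNumerator g := by
  have hdvd : (X 0 + X 1 : R 2) ∣ twoPointNumerator g := by
    refine Finset.dvd_sum fun d _ => ?_
    rcases Nat.eq_zero_or_pos d with rfl | hd
    · exact Dvd.dvd.mul_left (Dvd.dvd.mul_left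
        (dvd_pow (Dvd.intro_left _ rfl) (by simpa using hg)) _) _
    · refine Dvd.dvd.mul_right (Dvd.dvd.mul_left (dvd_pow (Dvd.dvd.mul_left ?_ _) hd.ne') _) _
      exact ⟨X 0 ^ 2 - X 0 * X 1 + X 1 ^ 2, by ring⟩
  obtain ⟨p, hp⟩ := hdvd
  have h : Fnpt 2 g = algebraMap (R 2) (K 2) p := by
    apply mul_left_cancel₀ SX_two_ne_zero
    rw [SX_mul_Fnpt_two, hp, map_mul, SX_two]
  rw [h, polyOf_algebraMap, hp]

lemma polyOf_Fnpt_one {g : ℕ} (hg : g ≠ 0) :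
    polyOf (Fnpt 1 g) = C (1 / (24 ^ g * (Nat.factorial g : ℚ))) * X 0 ^ (3 * g - 2) := by
  have hX : algebraMap (R 1) (K 1) (X 0) ≠ 0 := by simp [X_ne_zero]
  rw [← polyOf_algebraMap (C (1 / (24 ^ g * (Nat.factorial g : ℚ))) * X 0 ^ (3 * g - 2))]
  congr 1
  rw [Fnpt, Finset.sum_eq_single_of_mem g (by simp)]
  · rw [Nat.sub_self, Gnpt, Gf, SX3, Fin.sum_univ_one, map_mul, ← algebraMap_eq,
      ← IsScalarTower.algebraMap_apply, eq_ratCast, map_pow, map_pow]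
    have h3 : (algebraMap (R 1) (K 1) (X 0)) ^ (3 * g - 2) =
        ((algebraMap (R 1) (K 1) (X 0)) ^ 3) ^ g * (algebraMap (R 1) (K 1) (X 0)) ^ (-2 : ℤ) := by
      rw [← pow_mul, ← zpow_natCast, ← zpow_natCast, ← zpow_add₀ hX]
      congr 1
      omega
    rw [h3]
    push_cast
    field_simp
    rw [div_pow, div_mul_cancel₀ _ (pow_ne_zero g (by norm_num))]
  · intro d hd hdg
    obtain ⟨k, hk⟩ : ∃ k, g - d = k + 1 := ⟨g - d - 1, by have := Finset.mem_range.mp hd; omega⟩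
    rw [hk, Gnpt, Gf, mul_zero]

lemma sum_exp_mul_sum_exp {S : Type*} [CommRing S] [Algebra ℚ S] (A B : S) (W : ℕ → S) (g : ℕ) :
    ∑ ij ∈ antidiagonal g, (algebraMap ℚ S (1 / (Nat.factorial ij.1 : ℚ)) * A ^ ij.1) *
        ∑ dk ∈ antidiagonal ij.2,
          algebraMap ℚ S (1 / (Nat.factorial dk.1 : ℚ)) * B ^ dk.1 * W dk.2 =
      ∑ dk ∈ antidiagonal g,
        algebraMap ℚ S (1 / (Nat.factorial dk.1 : ℚ)) * (A + B) ^ dk.1 * W dk.2 := by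
  have h := congrArg (fun P => PowerSeries.coeff g (P * PowerSeries.mk W))
    (PowerSeries.exp_mul_exp_eq_exp_add A B)
  simp only [mul_assoc, PowerSeries.coeff_mul, PowerSeries.coeff_rescale, PowerSeries.coeff_exp,
    PowerSeries.coeff_mk] at h
  refine Eq.trans (Finset.sum_congr rfl fun ij _ => ?_)
    (h.trans (Finset.sum_congr rfl fun dk _ => by ring))
  rw [← mul_assoc, mul_comm (A ^ ij.1)]
  congr 1
  exact Finset.sum_congr rfl fun dk _ => by ring

lemma C_comp_algebraMap (n : ℕ) :
    (HahnSeries.C : R n →+* Lau n).comp (algebraMap ℚ (R n)) = algebraMap ℚ (Lau n) :=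
  Subsingleton.elim _ _

lemma algebraMap_Lau (n : ℕ) (q : ℚ) :
    algebraMap ℚ (Lau n) q = HahnSeries.C (MvPolynomial.C q) := by
  rw [← C_comp_algebraMap, RingHom.comp_apply, MvPolynomial.algebraMap_eq]

lemma sgnB_mul_self (σ : Bool) : sgnB σ * sgnB σ = 1 := by cases σ <;> simp [sgnB]

lemma yLau_pow {n : ℕ} (σ : Bool) (k : ℕ) :
    yLau n σ ^ k = HahnSeries.C (MvPolynomial.C (sgnB σ ^ k)) *
      HahnSeries.single (-(k : ℤ)) (1 : R n) := by
  rw [yLau_eq, mul_pow, HahnSeries.single_pow, one_pow, map_pow, map_pow, smul_neg, nsmul_one]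

lemma yLau_sq_mul {n : ℕ} (σ : Bool) :
    yLau n σ ^ 2 * HahnSeries.single (2 : ℤ) (1 : R n) = 1 := by
  rw [yLau_pow, pow_two, sgnB_mul_self, map_one, map_one, one_mul, HahnSeries.single_mul_single,
    one_mul]
  rfl

lemma FExp_empty (σ : Bool) (g : ℕ) :
    FExp σ g (∅ : Finset (Fin 1)) =
      algebraMap ℚ (Lau 1) (1 / (Nat.factorial g : ℚ)) *
        (algebraMap ℚ (Lau 1) (1 / 24) * yLau 1 σ ^ 3) ^ g *
        HahnSeries.single (2 : ℤ) (1 : R 1) := by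
  rcases Nat.eq_zero_or_pos g with rfl | hg
  · rw [FExp, if_pos ⟨rfl, rfl⟩]
    simp
  · rw [FExp, if_neg (fun h => hg.ne' h.1), if_neg (fun h => hg.ne' h.1), C_comp_algebraMap]
    have hE : ∀ v : Fin 1 → Lau 1, eval₂ (algebraMap ℚ (Lau 1)) v (polyOf (Fnpt 1 g)) =
        algebraMap ℚ (Lau 1) (1 / (24 ^ g * (Nat.factorial g : ℚ))) * v 0 ^ (3 * g - 2) := by
      intro v
      rw [polyOf_Fnpt_one hg.ne', eval₂_mul, eval₂_pow, eval₂_C, eval₂_X]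
    have h : yLau 1 σ ^ (3 * g - 2) =
        (yLau 1 σ ^ 3) ^ g * HahnSeries.single (2 : ℤ) (1 : R 1) := by
      rw [← pow_mul, ← Nat.sub_add_cancel (show 2 ≤ 3 * g by omega), pow_add, mul_assoc,
        Nat.sub_add_cancel (show 2 ≤ 3 * g by omega), yLau_sq_mul, mul_one]
    refine (hE _).trans ?_
    change _ * yLau 1 σ ^ (3 * g - 2) = _
    rw [h, mul_pow, ← map_pow, ← mul_assoc, ← mul_assoc, ← map_mul]
    congr 4
    rw [one_div_pow, one_div_mul_one_div, mul_comm]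

lemma eval₂_twoPointNumerator {S : Type*} [CommRing S] [Algebra ℚ S] (v : Fin 2 → S) (g : ℕ) :
    eval₂ (algebraMap ℚ S) v (twoPointNumerator g) =
      ∑ dk ∈ antidiagonal g, algebraMap ℚ S (1 / (Nat.factorial dk.1 : ℚ)) *
        (algebraMap ℚ S (1 / 24) * (v 0 ^ 3 + v 1 ^ 3)) ^ dk.1 *
        (algebraMap ℚ S (1 / (4 ^ dk.2 * (Nat.doubleFactorial (2 * dk.2 + 1) : ℚ))) *
          (v 0 * v 1 * (v 0 + v 1)) ^ dk.2) := by
  rw [twoPointNumerator, Finset.Nat.sum_antidiagonal_eq_sum_range_succ_mk, eval₂_sum]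
  simp only [eval₂_mul, eval₂_pow, eval₂_add, eval₂_C, eval₂_X]

lemma FExp_singleton (σ : Bool) (g : ℕ) :
    FExp σ g ({0} : Finset (Fin 1)) = LExp σ (X 0) (-1) *
      ∑ dk ∈ antidiagonal g, algebraMap ℚ (Lau 1) (1 / (Nat.factorial dk.1 : ℚ)) *
        (algebraMap ℚ (Lau 1) (1 / 24) * (yLau 1 σ ^ 3 + HahnSeries.C (X 0) ^ 3)) ^ dk.1 *
        (algebraMap ℚ (Lau 1) (1 / (4 ^ dk.2 * (Nat.doubleFactorial (2 * dk.2 + 1) : ℚ))) *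
          (yLau 1 σ * HahnSeries.C (X 0) * LExp σ (X 0) 1) ^ dk.2) := by
  rcases Nat.eq_zero_or_pos g with rfl | hg
  · rw [FExp, if_neg (by simp), if_pos (by simp), Finset.sum_singleton]
    simp
  · rw [FExp, if_neg (fun h => hg.ne' h.1), if_neg (fun h => hg.ne' h.1), C_comp_algebraMap]
    set v : Fin 2 → Lau 1 := Fin.cons (yLau 1 σ) (fun _ => HahnSeries.C (X 0))
    have hv0 : v 0 = yLau 1 σ := rfl
    have hv1 : v 1 = HahnSeries.C (X 0) := rfl
    have hE : eval₂ (algebraMap ℚ (Lau 1)) (Fin.cons (yLau 1 σ)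
          (fun i : Fin ({0} : Finset (Fin 1)).card =>
            HahnSeries.C (X ((({0} : Finset (Fin 1)).orderIsoOfFin rfl) i : Fin 1))))
          (polyOf (Fnpt (({0} : Finset (Fin 1)).card + 1) g)) =
        eval₂ (algebraMap ℚ (Lau 1)) v (polyOf (Fnpt 2 g)) := by
      have hx : (fun i : Fin ({0} : Finset (Fin 1)).card =>
            (HahnSeries.C (X ((({0} : Finset (Fin 1)).orderIsoOfFin rfl) i : Fin 1)) : Lau 1)) =
          fun _ => HahnSeries.C (X 0) := by
        funext i
        rw [Subsingleton.elim ((({0} : Finset (Fin 1)).orderIsoOfFin rfl) i : Fin 1) 0]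
      rw [hx]
      rfl
    have hN := congrArg (eval₂ (algebraMap ℚ (Lau 1)) v) (mul_polyOf_Fnpt_two hg.ne')
    rw [eval₂_mul, eval₂_add, eval₂_X, eval₂_X, eval₂_twoPointNumerator, hv0, hv1,
      ← LExp_one] at hN
    rw [hE, ← hN, ← mul_assoc, ← LExp_add, neg_add_cancel, LExp_zero, one_mul]

lemma sum_FExp_mul_FExp (σ τ : Bool) (hστ : yLau 1 σ = -yLau 1 τ) (g : ℕ) :
    ∑ ij ∈ antidiagonal g, FExp σ ij.1 (∅ : Finset (Fin 1)) * FExp τ ij.2 ({0} : Finset (Fin 1)) =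
      HahnSeries.single (2 : ℤ) (1 : R 1) * LExp τ (X 0) (-1) *
      ∑ dk ∈ antidiagonal g, algebraMap ℚ (Lau 1) (1 / (Nat.factorial dk.1 : ℚ)) *
        (algebraMap ℚ (Lau 1) (1 / 24) * HahnSeries.C (X 0) ^ 3) ^ dk.1 *
        (algebraMap ℚ (Lau 1) (1 / (4 ^ dk.2 * (Nat.doubleFactorial (2 * dk.2 + 1) : ℚ))) *
          (yLau 1 τ * HahnSeries.C (X 0) * LExp τ (X 0) 1) ^ dk.2) := by
  have h : algebraMap ℚ (Lau 1) (1 / 24) * HahnSeries.C (X 0) ^ 3 =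
      algebraMap ℚ (Lau 1) (1 / 24) * yLau 1 σ ^ 3 +
        algebraMap ℚ (Lau 1) (1 / 24) * (yLau 1 τ ^ 3 + HahnSeries.C (X 0) ^ 3) := by
    rw [hστ]
    ring
  have h2 := sum_exp_mul_sum_exp (algebraMap ℚ (Lau 1) (1 / 24) * yLau 1 σ ^ 3)
    (algebraMap ℚ (Lau 1) (1 / 24) * (yLau 1 τ ^ 3 + HahnSeries.C (X 0) ^ 3))
    (fun k => algebraMap ℚ (Lau 1) (1 / (4 ^ k * (Nat.doubleFactorial (2 * k + 1) : ℚ))) *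
          (yLau 1 τ * HahnSeries.C (X 0) * LExp τ (X 0) 1) ^ k) g
  rw [h, ← h2, Finset.mul_sum]
  refine Finset.sum_congr rfl fun ij _ => ?_
  rw [FExp_empty, FExp_singleton]
  ring

lemma binomZ_one (p : ℤ) : binomZ p 1 = p := by simp [binomZ]

lemma coeffL_C_mul_single_mul {n : ℕ} (r : R n) (e : ℤ) (Z : Lau n) (k : ℤ) (d : Fin n → ℕ) :
    coeffL (HahnSeries.C r * HahnSeries.single e (1 : R n) * Z) k d =
      MvPolynomial.coeff (Finsupp.equivFunOnFinite.symm d) (r * Z.coeff (-k - e)) := by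
  rw [coeffL, mul_assoc, HahnSeries.C_mul_eq_smul, HahnSeries.coeff_smul,
    HahnSeries.coeff_single_mul, one_mul, smul_eq_mul]

lemma coeffL_sum {n : ℕ} {ι : Type*} (s : Finset ι) (f : ι → Lau n) (k : ℤ) (d : Fin n → ℕ) :
    coeffL (∑ i ∈ s, f i) k d = ∑ i ∈ s, coeffL (f i) k d := by
  rw [coeffL, HahnSeries.coeff_sum, MvPolynomial.coeff_sum]
  rfl

lemma coeffL_add {n : ℕ} (f f' : Lau n) (k : ℤ) (d : Fin n → ℕ) :
    coeffL (f + f') k d = coeffL f k d + coeffL f' k d := by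
  rw [coeffL, HahnSeries.coeff_add, MvPolynomial.coeff_add]
  rfl

lemma LExp_mul_term_eq (σ τ : Bool) (p q : ℤ) (d k : ℕ) (u v : ℚ) :
    LExp σ (0 : R 1) p * LExp τ (X 0) q *
        (HahnSeries.single (2 : ℤ) (1 : R 1) * LExp τ (X 0) (-1) *
          (algebraMap ℚ (Lau 1) u * (algebraMap ℚ (Lau 1) (1 / 24) * HahnSeries.C (X 0) ^ 3) ^ d *
            (algebraMap ℚ (Lau 1) v *
              (yLau 1 τ * HahnSeries.C (X 0) * LExp τ (X 0) 1) ^ k))) =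
      HahnSeries.C (MvPolynomial.C (sgnB σ ^ p * sgnB τ ^ k * u * (1 / 24) ^ d * v) *
        X 0 ^ (3 * d + k)) * HahnSeries.single (2 - p - k) (1 : R 1) *
        LExp τ (X 0) (q - 1 + k) := by
  have hs : HahnSeries.single (2 - p - k) (1 : R 1) =
      HahnSeries.single (-p) (1 : R 1) * HahnSeries.single (2 : ℤ) (1 : R 1) *
        HahnSeries.single (-(k : ℤ)) (1 : R 1) := by
    rw [HahnSeries.single_mul_single, HahnSeries.single_mul_single, one_mul, one_mul,
      show 2 - p - k = -p + 2 + -(k : ℤ) by ring]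
  rw [mul_pow _ (LExp _ _ _), mul_pow (yLau _ _), yLau_pow, LExp_one_pow, LExp_of_zero,
    LExp_add τ _ (q - 1), sub_eq_add_neg q, LExp_add τ _ q, hs, mul_pow (algebraMap _ _ _),
    algebraMap_Lau, algebraMap_Lau, algebraMap_Lau]
  simp only [map_mul, map_pow, pow_add, pow_mul]
  ring

lemma coeffL_LExp_mul_sum_FExp (σ τ : Bool) (hστ : yLau 1 σ = -yLau 1 τ) (g : ℕ) (p q : ℤ) :
    coeffL (LExp σ (0 : R 1) p * LExp τ (X 0) q *
        ∑ ij ∈ antidiagonal g,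
          FExp σ ij.1 (∅ : Finset (Fin 1)) * FExp τ ij.2 ({0} : Finset (Fin 1)))
        (2 * (g : ℤ) - 4 + p + q) (fun _ => g + 1) =
      sgnB σ ^ p * sgnB τ ^ q * ((g : ℚ) - 1 + q) /
        (4 ^ g * (Nat.doubleFactorial (2 * g + 1) : ℚ)) := by
  rw [sum_FExp_mul_FExp σ τ hστ, Finset.mul_sum, Finset.mul_sum, coeffL_sum,
    Finset.sum_eq_single_of_mem (0, g) (by simp)]
  · rw [LExp_mul_term_eq, coeffL_C_mul_single_mul,
      show -(2 * (g : ℤ) - 4 + p + q) - (2 - p - g) = ((1 : ℕ) : ℤ) - (q - 1 + g) by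
        push_cast; ring,
      coeff_LExp, binomZ_one, mul_mul_mul_comm, ← map_mul, mul_zero, zero_add, pow_one,
      ← pow_succ, coeff_C_mul, X_pow_eq_monomial, coeff_monomial, if_pos, mul_one]
    · rw [show q - 1 + (g : ℤ) + ((1 : ℕ) : ℤ) = q + g by push_cast; ring,
        zpow_add₀ (sgnB_ne_zero τ), zpow_natCast]
      have hg : sgnB τ ^ g * sgnB τ ^ g = 1 := by
        rw [← mul_pow, sgnB_mul_self, one_pow]
      push_cast
      simp only [Nat.factorial_zero, pow_zero, Nat.cast_one]
      linear_combination (sgnB σ ^ p * sgnB τ ^ q * ((g : ℚ) - 1 + q) /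
        (4 ^ g * (Nat.doubleFactorial (2 * g + 1) : ℚ))) * hg
    · refine Finsupp.ext fun i => ?_
      rw [Subsingleton.elim i 0]
      simp
  · rintro ⟨d, k⟩ hdk hne
    have hsum : d + k = g := mem_antidiagonal.mp hdk
    have hd : d ≠ 0 := by
      rintro rfl
      exact hne (by rw [← hsum, zero_add])
    rw [LExp_mul_term_eq, coeffL_C_mul_single_mul, mul_assoc, coeff_C_mul, X_pow_eq_monomial,
      coeff_monomial_mul', if_neg, mul_zero]
    intro hle
    have := hle 0
    simp at this
    omega

/-- Lemma 4.2 (ii): in the one-variable case,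
`[L_g^{a,b}(y,x)]_{y^{2g−4+a+b} x^{g+1}} = (−1)^b (2g−2+a+b)/(4^g (2g+1)!!)`. -/
theorem lemma_4_2_ii (g : ℕ) (a b : ℤ) :
    coeffL (LL g 1 a b) (2*(g : ℤ) - 4 + a + b) (fun _ => g+1)
      = (-1 : ℚ)^b * (((2*(g : ℤ) - 2 + a + b) : ℤ) : ℚ) /
          (4^g * (Nat.doubleFactorial (2*g+1) : ℚ)) := by
  have hu : (univ : Finset (Finset (Fin 1))) = {∅, {0}} := by decide
  have h0 : (∅ᶜ : Finset (Fin 1)) = {0} := by decide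
  have h1 : ({0}ᶜ : Finset (Fin 1)) = ∅ := by decide
  have hy : yLau 1 true = -yLau 1 false := by
    have hC : (HahnSeries.C (MvPolynomial.C (sgnB true)) : Lau 1) =
        -HahnSeries.C (MvPolynomial.C (sgnB false)) := by
      rw [← map_neg, ← map_neg]
      simp [sgnB]
    rw [yLau_eq, yLau_eq]
    linear_combination HahnSeries.single (-1 : ℤ) (1 : R 1) * hC
  have hL : LL g 1 a b =
      LExp true (0 : R 1) a * LExp false (X 0) b * ∑ ij ∈ antidiagonal g,
        FExp true ij.1 (∅ : Finset (Fin 1)) * FExp false ij.2 ({0} : Finset (Fin 1)) +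
      LExp false (0 : R 1) b * LExp true (X 0) a * ∑ ij ∈ antidiagonal g,
        FExp false ij.1 (∅ : Finset (Fin 1)) * FExp true ij.2 ({0} : Finset (Fin 1)) := by
    rw [LL, ← Finset.Nat.sum_antidiagonal_eq_sum_range_succ (fun i j => ∑ I : Finset (Fin 1),
      LExp true (∑ i ∈ I, X i) a * LExp false (∑ i ∈ Iᶜ, X i) b * FExp true i I * FExp false j Iᶜ),
      ← Finset.Nat.sum_antidiagonal_swap (n := g) (f := fun ij : ℕ × ℕ =>
        FExp false ij.1 (∅ : Finset (Fin 1)) * FExp true ij.2 ({0} : Finset (Fin 1))),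
      Finset.mul_sum, Finset.mul_sum, ← Finset.sum_add_distrib]
    refine Finset.sum_congr rfl fun ij _ => ?_
    rw [hu, Finset.sum_pair (by decide), h0, h1, Finset.sum_empty, Finset.sum_singleton]
    simp only [Prod.fst_swap, Prod.snd_swap]
    ring
  rw [hL, coeffL_add, coeffL_LExp_mul_sum_FExp true false hy, add_right_comm _ a b,
    coeffL_LExp_mul_sum_FExp false true (by rw [hy, neg_neg])]
  simp only [sgnB, if_true, Bool.false_eq_true, if_false, one_zpow]
  push_cast
  ring

end
end

section
/- Let a, b ∈ ℤ and n ≥ 1. In genus 0 one has L_0^{a,b}(y,x_1,…,x_n) = Σ_{{1,…,n}=I⊔J} (y+Σ_{i∈I}x_i)^{|I|−2+a} (−y+Σ_{i∈J}x_i)^{|J|−2+b} (sum over ordered pairs of disjoint, possibly empty, sets with union {1,…,n}), and for every integer k ≥ a+b−3, [L_0^{a,b}(y,x_1,…,x_n)]_{y^k} = 0; that is, the coefficient of y^k Π_j x_j^{d_j} vanishes for all integers d_1,…,d_n ≥ 0. -/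
open MvPolynomial Finset

noncomputable section

/-! ### Setting a variable to zero -/

/-- The substitution `x_i = 0`. -/
def setZero {n : ℕ} (i : Fin n) : R n →ₐ[ℚ] R n :=
  MvPolynomial.aeval fun j => if j = i then 0 else X j

lemma setZero_monomial {n : ℕ} (i : Fin n) (s : Fin n →₀ ℕ) (hs : s i ≠ 0) (r : ℚ) :
    setZero i (monomial s r) = 0 := by
  rw [setZero, aeval_monomial, Finsupp.prod,
    Finset.prod_eq_zero (Finsupp.mem_support_iff.mpr hs), mul_zero]
  simp [hs]

lemma setZero_monomial_of_eq_zero {n : ℕ} (i : Fin n) (s : Fin n →₀ ℕ) (hs : s i = 0) (r : ℚ) :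
    setZero i (monomial s r) = monomial s r := by
  rw [setZero, aeval_monomial, monomial_eq, algebraMap_eq]
  congr 1
  refine Finset.prod_congr rfl fun j hj => ?_
  have hji : j ≠ i := by
    rintro rfl
    exact Finsupp.mem_support_iff.mp hj hs
  simp only [if_neg hji]

lemma coeff_setZero {n : ℕ} (i : Fin n) (m : Fin n →₀ ℕ) (hm : m i = 0) (p : R n) :
    coeff m (setZero i p) = coeff m p := by
  induction p using MvPolynomial.induction_on' with
  | monomial s r =>
    by_cases hs : s i = 0
    · rw [setZero_monomial_of_eq_zero i s hs]
    · rw [setZero_monomial i s hs, coeff_zero, coeff_monomial, if_neg]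
      rintro rfl
      exact hs hm
  | add p q hp hq => rw [map_add, coeff_add, coeff_add, hp, hq]

/-- A polynomial of degree less than the size of `S` is determined by its restrictions to the
hyperplanes `x_i = 0`, `i ∈ S`. -/
lemma eq_of_setZero_eq {n : ℕ} {S : Finset (Fin n)} {p q : R n} (hp : p.totalDegree < S.card)
    (hq : q.totalDegree < S.card) (h : ∀ i ∈ S, setZero i p = setZero i q) : p = q := by
  ext m
  by_cases hm : ∃ i ∈ S, m i = 0
  · obtain ⟨i, hi, hmi⟩ := hm
    rw [← coeff_setZero i m hmi, h i hi, coeff_setZero i m hmi]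
  · push Not at hm
    have hS : S.card ≤ ∑ i ∈ m.support, m i := by
      calc S.card = ∑ i ∈ S, 1 := by simp
        _ ≤ ∑ i ∈ S, m i := Finset.sum_le_sum fun i hi => Nat.one_le_iff_ne_zero.mpr (hm i hi)
        _ ≤ ∑ i ∈ m.support, m i :=
          Finset.sum_le_sum_of_subset fun i hi => Finsupp.mem_support_iff.mpr (hm i hi)
    rw [coeff_eq_zero_of_totalDegree_lt (hp.trans_le hS),
      coeff_eq_zero_of_totalDegree_lt (hq.trans_le hS)]

lemma setZero_sum_X {n : ℕ} {i : Fin n} {I : Finset (Fin n)} (hi : i ∉ I) :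
    setZero i (∑ j ∈ I, X j) = ∑ j ∈ I, X j := by
  rw [map_sum]
  refine Finset.sum_congr rfl fun j hj => ?_
  rw [setZero, aeval_X, if_neg]
  rintro rfl
  exact hi hj

lemma setZero_sum_X_insert {n : ℕ} {i : Fin n} {I : Finset (Fin n)} (hi : i ∉ I) :
    setZero i (∑ j ∈ insert i I, X j) = ∑ j ∈ I, X j := by
  rw [Finset.sum_insert hi, map_add, setZero_sum_X hi, setZero, aeval_X, if_pos rfl, zero_add]

lemma totalDegree_sum_X_le {n : ℕ} (I : Finset (Fin n)) :
    (∑ j ∈ I, X j : R n).totalDegree ≤ 1 :=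
  (totalDegree_finsetSum _ _).trans (Finset.sup_le fun j _ => (totalDegree_X j).le)

lemma totalDegree_sum_X_pow_le {n : ℕ} (I : Finset (Fin n)) (k : ℕ) :
    ((∑ j ∈ I, X j : R n) ^ k).totalDegree ≤ k :=
  (totalDegree_pow _ _).trans (by simpa using Nat.mul_le_mul_left k (totalDegree_sum_X_le I))

/-! ### Hurwitz's identity -/

/-- `(Σ_I x)^{|I|−1}`, with value `0` for `I = ∅`. -/
def hurwitzTerm {n : ℕ} (I : Finset (Fin n)) : R n :=
  if I = ∅ then 0 else (∑ i ∈ I, X i) ^ (I.card - 1)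

lemma sum_X_mul_hurwitzTerm {n : ℕ} (I : Finset (Fin n)) :
    (∑ i ∈ I, X i) ^ I.card = (∑ i ∈ I, X i) * hurwitzTerm I + if I = ∅ then 1 else 0 := by
  rcases eq_or_ne I ∅ with rfl | h
  · simp [hurwitzTerm]
  · rw [hurwitzTerm, if_neg h, if_neg h, add_zero, ← pow_succ',
      Nat.sub_add_cancel (Finset.card_pos.mpr (Finset.nonempty_iff_ne_empty.mpr h))]

lemma totalDegree_hurwitzTerm_le {n : ℕ} (I : Finset (Fin n)) :
    (hurwitzTerm I).totalDegree ≤ I.card - 1 := by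
  rw [hurwitzTerm]
  split_ifs
  · simp
  · exact totalDegree_sum_X_pow_le _ _

lemma setZero_hurwitzTerm {n : ℕ} {i : Fin n} {I : Finset (Fin n)} (hi : i ∉ I) :
    setZero i (hurwitzTerm I) = hurwitzTerm I := by
  rw [hurwitzTerm]
  split_ifs
  · simp
  · rw [map_pow, setZero_sum_X hi]

lemma setZero_hurwitzTerm_insert {n : ℕ} {i : Fin n} {I : Finset (Fin n)} (hi : i ∉ I) :
    setZero i (hurwitzTerm (insert i I)) = (∑ j ∈ I, X j) ^ I.card := by
  rw [hurwitzTerm, if_neg (Finset.insert_ne_empty i I), map_pow, setZero_sum_X_insert hi,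
    Finset.card_insert_of_notMem hi, Nat.add_sub_cancel]

lemma sum_X_add_sum_sdiff_X {n : ℕ} {I S : Finset (Fin n)} (h : I ⊆ S) :
    (∑ i ∈ I, X i + ∑ i ∈ S \ I, X i : R n) = ∑ i ∈ S, X i := by
  rw [add_comm, Finset.sum_sdiff h]

theorem sum_hurwitzTerm_mul {n : ℕ} (S : Finset (Fin n)) (hS : S.Nonempty) :
    ∑ I ∈ S.powerset, hurwitzTerm I * hurwitzTerm (S \ I)
      = 2 * ((S.card - 1 : ℕ) : R n) * (∑ i ∈ S, X i) ^ (S.card - 2) := by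
  induction hc : S.card generalizing S with
  | zero => simp_all
  | succ c ih =>
    refine eq_of_setZero_eq (S := S) ?_ ?_ fun i hi => ?_
    · refine lt_of_le_of_lt (totalDegree_finsetSum _ _) ?_
      rw [Finset.sup_lt_iff (by simp [hc])]
      intro I hI
      rw [Finset.mem_powerset] at hI
      have h1 := totalDegree_hurwitzTerm_le I
      have h2 := totalDegree_hurwitzTerm_le (S \ I)
      have h3 := Finset.card_sdiff_add_card_eq_card hI
      have h4 := totalDegree_mul (hurwitzTerm I) (hurwitzTerm (S \ I))
      by_cases hI0 : I.card = 0
      · rw [Finset.card_eq_zero] at hI0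
        simp [hurwitzTerm, hI0, hc]
      · omega
    · have h : (2 * ((c + 1 - 1 : ℕ) : R n)).totalDegree = 0 := by
        have : (2 * ((c + 1 - 1 : ℕ) : R n)) = C (2 * ((c + 1 - 1 : ℕ) : ℚ)) := by
          rw [map_mul, map_natCast, map_ofNat]
        rw [this, totalDegree_C]
      have h1 := totalDegree_mul (2 * ((c + 1 - 1 : ℕ) : R n))
        ((∑ i ∈ S, X i) ^ (c + 1 - 2))
      have h2 := totalDegree_sum_X_pow_le S (c + 1 - 2)
      omega
    · obtain ⟨T, hiT, rfl⟩ : ∃ T, i ∉ T ∧ insert i T = S :=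
        ⟨S.erase i, Finset.notMem_erase i S, Finset.insert_erase hi⟩
      rw [Finset.card_insert_of_notMem hiT, Nat.add_right_cancel_iff] at hc
      rw [map_sum, Finset.sum_powerset_insert hiT, ← Finset.sum_add_distrib, map_mul, map_mul,
        map_pow, setZero_sum_X_insert hiT, map_natCast, map_ofNat]
      have key : ∀ I ∈ T.powerset,
          setZero i (hurwitzTerm I * hurwitzTerm (insert i T \ I)) +
            setZero i (hurwitzTerm (insert i I) * hurwitzTerm (insert i T \ insert i I))
          = (∑ j ∈ T, X j) * (hurwitzTerm I * hurwitzTerm (T \ I)) +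
            ((if T \ I = ∅ then hurwitzTerm I else 0) +
              (if I = ∅ then hurwitzTerm (T \ I) else 0)) := by
        intro I hI
        rw [Finset.mem_powerset] at hI
        have hiI : i ∉ I := fun h => hiT (hI h)
        have hiJ : i ∉ T \ I := fun h => hiT (Finset.sdiff_subset h)
        rw [Finset.insert_sdiff_insert, Finset.sdiff_insert_of_notMem hiT,
          Finset.insert_sdiff_of_notMem _ hiI, map_mul, map_mul,
          setZero_hurwitzTerm hiI, setZero_hurwitzTerm hiJ, setZero_hurwitzTerm_insert hiI,
          setZero_hurwitzTerm_insert hiJ, sum_X_mul_hurwitzTerm, sum_X_mul_hurwitzTerm,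
          ← sum_X_add_sum_sdiff_X hI]
        split_ifs <;> ring
      rw [Finset.sum_congr rfl key, Finset.sum_add_distrib, ← Finset.mul_sum,
        Finset.sum_add_distrib]
      have e1 : ∑ I ∈ T.powerset, (if T \ I = ∅ then hurwitzTerm I else 0) = hurwitzTerm T := by
        rw [Finset.sum_eq_single T]
        · simp
        · intro I hI hne
          rw [Finset.mem_powerset] at hI
          rw [if_neg]
          intro h
          exact hne (hI.antisymm (Finset.sdiff_eq_empty_iff_subset.mp h))
        · simp
      have e2 : ∑ I ∈ T.powerset, (if I = ∅ then hurwitzTerm (T \ I) else 0) = hurwitzTerm T := by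
        simp
      rw [e1, e2]
      rcases T.eq_empty_or_nonempty with rfl | hT
      · simp at hc
        simp [hurwitzTerm, ← hc]
      · rw [ih T hT hc, hurwitzTerm, if_neg hT.ne_empty, hc]
        have hc0 : 0 < c := hc ▸ hT.card_pos
        obtain ⟨c, rfl⟩ := Nat.exists_eq_succ_of_ne_zero hc0.ne'
        rcases c with _ | c
        · simp [one_add_one_eq_two]
        · simp only [Nat.succ_eq_add_one, Nat.add_sub_cancel,
            show c + 1 + 1 - 2 = c by omega, show c + 1 + 1 + 1 - 2 = c + 1 by omega]
          push_cast
          ring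

lemma sum_orderIsoOfFin {n : ℕ} {M : Type*} [AddCommMonoid M] (I : Finset (Fin n))
    (f : Fin n → M) :
    ∑ j : Fin I.card, f ((I.orderIsoOfFin rfl) j : Fin n) = ∑ i ∈ I, f i := by
  rw [← Finset.sum_coe_sort I f]
  exact (I.orderIsoOfFin rfl).toEquiv.sum_comp fun i => f i

lemma emb_SX {n : ℕ} (I : Finset (Fin n)) :
    emb I (SX I.card) = algebraMap (R n) (K n) (∑ i ∈ I, X i) := by
  rw [SX, emb_algebraMap, embRH, RingHom.comp_apply]
  congr 1
  simp only [AlgHom.toRingHom_eq_coe, RingHom.coe_coe, map_sum, rename_X]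
  exact sum_orderIsoOfFin I X

lemma sum_X_ne_zero {n : ℕ} {I : Finset (Fin n)} (hI : I.Nonempty) :
    (∑ i ∈ I, X i : R n) ≠ 0 := by
  obtain ⟨i, hi⟩ := hI
  intro h
  have := congrArg (MvPolynomial.eval (Pi.single i (1 : ℚ))) h
  simp [Pi.single_apply, hi] at this

lemma sum_X_sq_mul_emb {n : ℕ} {I : Finset (Fin n)} (hI : I.Nonempty) :
    (algebraMap (R n) (K n) (∑ i ∈ I, X i)) ^ 2 * emb I (SX I.card ^ ((I.card : ℤ) - 3))
      = algebraMap (R n) (K n) (hurwitzTerm I) := by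
  have h0 : algebraMap (R n) (K n) (∑ i ∈ I, X i) ≠ 0 := by
    rw [Ne, FaithfulSMul.algebraMap_eq_zero_iff]
    exact sum_X_ne_zero hI
  rw [map_zpow₀, emb_SX, hurwitzTerm, if_neg hI.ne_empty, map_pow, ← zpow_natCast,
    ← zpow_natCast, ← zpow_add₀ h0]
  congr 1
  push_cast [Nat.cast_sub hI.card_pos]
  ring

lemma doubleFactorial_quotient_mul {F : Type*} [Field F] [CharZero F] (m : ℕ) {s : F}
    (hs : s ≠ 0) :
    ((Nat.doubleFactorial (m + 2 - 3) : ℕ) : F) / (Nat.doubleFactorial (m + 2 - 1) : ℕ) *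
      ((2 * s)⁻¹ * (2 * ((m + 1 : ℕ) : F) * s ^ m)) = s ^ ((m : ℤ) - 1) := by
  have hd : ((Nat.doubleFactorial (m + 2 - 1) : ℕ) : F)
      = ((m + 1 : ℕ) : F) * (Nat.doubleFactorial (m + 2 - 3) : ℕ) := by
    rcases m with _ | m
    · simp
    · rw [show m + 1 + 2 - 1 = m + 2 by omega, show m + 1 + 2 - 3 = m by omega,
        Nat.doubleFactorial_add_two]
      push_cast
      ring
  have hd0 : ((Nat.doubleFactorial (m + 2 - 3) : ℕ) : F) ≠ 0 :=
    Nat.cast_ne_zero.mpr (Nat.doubleFactorial_pos _).ne'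
  have hm0 : ((m + 1 : ℕ) : F) ≠ 0 := Nat.cast_ne_zero.mpr (Nat.succ_ne_zero m)
  rw [hd, zpow_sub_one₀ hs, zpow_natCast]
  field_simp

lemma Gf_succ_zero (fuel m : ℕ)
    (h : ∀ k, 1 ≤ k → k ≤ m + 1 → Gf fuel k 0 = SX k ^ ((k : ℤ) - 3)) :
    Gf (fuel + 1) (m + 2) 0 = SX (m + 2) ^ ((m : ℤ) - 1) := by
  have hterm : ∀ I : Finset (Fin (m + 2)),
      (if I ≠ ∅ ∧ I ≠ univ then
          (algebraMap (R (m + 2)) (K (m + 2)) (∑ i ∈ I, X i)) ^ 2 *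
          (algebraMap (R (m + 2)) (K (m + 2)) (∑ i ∈ Iᶜ, X i)) ^ 2 *
          ∑ r' ∈ Finset.range (0 - 0 + 1),
            emb I (Gf fuel I.card r') * emb Iᶜ (Gf fuel Iᶜ.card (0 - 0 - r'))
        else 0)
      = algebraMap (R (m + 2)) (K (m + 2)) (hurwitzTerm I * hurwitzTerm (univ \ I)) := by
    intro I
    rcases I.eq_empty_or_nonempty with rfl | hI
    · rw [if_neg (by simp), hurwitzTerm, if_pos rfl, zero_mul, map_zero]
    rcases eq_or_ne I univ with rfl | hI'
    · rw [if_neg (by simp), Finset.sdiff_self, hurwitzTerm, hurwitzTerm, if_pos rfl, mul_zero,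
        map_zero]
    have hJ : Iᶜ.Nonempty := by
      rwa [Finset.nonempty_iff_ne_empty, Ne, Finset.compl_eq_empty_iff]
    have h1 := hI.card_pos
    have h2 := hJ.card_pos
    have h3 : I.card + Iᶜ.card = m + 2 := by
      rw [Finset.card_add_card_compl, Fintype.card_fin]
    rw [if_pos ⟨hI.ne_empty, hI'⟩, ← Finset.compl_eq_univ_sdiff, map_mul,
      ← sum_X_sq_mul_emb hI, ← sum_X_sq_mul_emb hJ, Nat.sub_self, zero_add,
      Finset.sum_range_one, h I.card (by omega) (by omega), h Iᶜ.card (by omega) (by omega),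
      mul_mul_mul_comm]
  have h0 : SX (m + 2) ≠ 0 := by
    rw [SX, Ne, FaithfulSMul.algebraMap_eq_zero_iff]
    exact sum_X_ne_zero Finset.univ_nonempty
  rw [Gf, zero_add, Finset.sum_range_one, Finset.sum_congr rfl fun I _ => hterm I,
    ← Finset.powerset_univ, ← map_sum, sum_hurwitzTerm_mul univ Finset.univ_nonempty,
    ← doubleFactorial_quotient_mul m h0, Finset.card_univ, Fintype.card_fin, map_mul, map_mul,
    map_pow, map_natCast, map_ofNat, ← SX, pow_zero, pow_zero, one_mul, mul_one,
    Rat.cast_natCast, Rat.cast_natCast, Nat.sub_self, mul_zero, zero_add,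
    Nat.add_sub_cancel, show m + 2 - 1 = m + 1 from rfl]

theorem Gf_zero (fuel n : ℕ) (hn : 1 ≤ n) (hf : n ≤ fuel + 1) :
    Gf fuel n 0 = SX n ^ ((n : ℤ) - 3) := by
  induction fuel generalizing n with
  | zero =>
    obtain rfl : n = 1 := by omega
    simp [Gf, SX]
  | succ fuel ih =>
    obtain rfl | ⟨m, rfl⟩ : n = 1 ∨ ∃ m, n = m + 2 := by
      rcases hn.eq_or_lt with h | h
      · exact Or.inl h.symm
      · exact Or.inr ⟨n - 2, by omega⟩
    · simp [Gf, SX]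
    · rw [Gf_succ_zero fuel m fun k h1 h2 => ih k h1 (by omega)]
      congr 1
      push_cast
      ring

theorem polyOf_Fnpt_zero (n : ℕ) (hn : 3 ≤ n) :
    polyOf (Fnpt n 0) = (∑ j, X j) ^ (n - 3) := by
  have h : algebraMap (R n) (K n) ((∑ j, X j) ^ (n - 3)) = Fnpt n 0 := by
    have h3 : ((n : ℤ) - 3) = ((n - 3 : ℕ) : ℤ) := by omega
    simp [Fnpt, Gnpt, Gf_zero n n (by omega) (by omega), h3, SX]
  have hex : ∃ p : R n, algebraMap (R n) (K n) p = Fnpt n 0 := ⟨_, h⟩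
  rw [polyOf, dif_pos hex]
  exact IsFractionRing.injective (R n) (K n) (hex.choose_spec.trans h.symm)

/-! ### Powers of `±y + c` -/

lemma binomZ_zero_left (k : ℕ) : binomZ 0 k = if k = 0 then 1 else 0 := by
  rcases k with _ | k
  · simp [binomZ]
  · rw [binomZ, Finset.prod_eq_zero (Finset.mem_range.mpr k.succ_pos) (by simp), zero_div,
      if_neg k.succ_ne_zero]

lemma binomZ_zero_right (p : ℤ) : binomZ p 0 = 1 := by simp [binomZ]

lemma binomZ_succ_succ (p : ℤ) (k : ℕ) :
    binomZ (p + 1) (k + 1) = binomZ p (k + 1) + binomZ p k := by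
  rw [binomZ, binomZ, binomZ, Finset.prod_range_succ', Finset.prod_range_succ,
    Nat.factorial_succ]
  have h : ∏ i ∈ Finset.range k, (((p + 1 : ℤ) : ℚ) - ((i + 1 : ℕ) : ℚ))
      = ∏ i ∈ Finset.range k, ((p : ℚ) - i) :=
    Finset.prod_congr rfl fun i _ => by push_cast; ring
  rw [h]
  have h0 : (Nat.factorial k : ℚ) ≠ 0 := Nat.cast_ne_zero.mpr (Nat.factorial_ne_zero k)
  have h1 : ((k : ℚ) + 1) ≠ 0 := by exact_mod_cast Nat.succ_ne_zero k
  push_cast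
  field_simp
  ring

/-- The power series `(1 + c t)^m`. -/
def binomPS {n : ℕ} (c : R n) (m : ℤ) : PowerSeries (R n) :=
  PowerSeries.mk fun k => MvPolynomial.C (binomZ m k) * c ^ k

lemma binomPS_zero {n : ℕ} (c : R n) : binomPS c 0 = 1 := by
  ext1 k
  rw [binomPS, PowerSeries.coeff_mk, binomZ_zero_left, PowerSeries.coeff_one]
  split_ifs with h
  · simp [h]
  · simp

lemma binomPS_add_one {n : ℕ} (c : R n) (m : ℤ) :
    binomPS c (m + 1) = binomPS c m * (1 + PowerSeries.C c * PowerSeries.X) := by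
  ext1 k
  rw [mul_add, mul_one, ← mul_assoc, map_add]
  rcases k with _ | k
  · simp [binomPS, binomZ_zero_right]
  · rw [PowerSeries.coeff_succ_mul_X, PowerSeries.coeff_mul_C]
    simp only [binomPS, PowerSeries.coeff_mk, binomZ_succ_succ, map_add]
    ring

/-- The sign `(±1)^m`. -/
def ySign {n : ℕ} (σ : Bool) (m : ℤ) : R n :=
  if σ then 1 else if Even m then 1 else -1

lemma ySign_add_one {n : ℕ} (σ : Bool) (m : ℤ) :
    (ySign σ (m + 1) : R n) = ySign σ m * if σ then 1 else -1 := by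
  rcases σ with _ | _
  · by_cases h : Even m <;> simp [ySign, h]
  · simp [ySign]

lemma LExp_eq_s14 {n : ℕ} (σ : Bool) (c : R n) (m : ℤ) :
    LExp σ c m = HahnSeries.single (-m) (ySign σ m) *
      HahnSeries.ofPowerSeries ℤ (R n) (binomPS ((if σ then 1 else -1) * c) m) := by
  have h : (if σ then 1 else if Even m then 1 else -1 : Lau n) * HahnSeries.single (-m) (1 : R n)
      = HahnSeries.single (-m) (ySign σ m) := by
    rw [ySign]
    split_ifs
    · exact one_mul _
    · exact one_mul _
    · rw [HahnSeries.single_neg]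
      ring
  rw [LExp, yExpAdd, ← mul_assoc, h, binomPS]

lemma LExp_add_one {n : ℕ} (σ : Bool) (c : R n) (m : ℤ) :
    LExp σ c (m + 1) = LExp σ c m * (yLau n σ + HahnSeries.C c) := by
  set ε : R n := if σ then 1 else -1 with hε
  have hεε : ε * ε = 1 := by rw [hε]; split_ifs <;> simp
  have hy : yLau n σ = HahnSeries.single (-1) ε := by
    rw [yLau, hε]
    split_ifs
    · exact one_mul _
    · rw [HahnSeries.single_neg]
      ring
  have hu : yLau n σ + HahnSeries.C c = HahnSeries.single (-1) ε *
      HahnSeries.ofPowerSeries ℤ (R n) (1 + PowerSeries.C (ε * c) * PowerSeries.X) := by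
    rw [hy, map_add, map_one, map_mul, HahnSeries.ofPowerSeries_C, HahnSeries.ofPowerSeries_X,
      mul_add, mul_one, HahnSeries.C_apply, HahnSeries.C_apply, HahnSeries.single_mul_single,
      HahnSeries.single_mul_single, mul_one, ← mul_assoc, hεε, one_mul]
    simp
  rw [hu, LExp_eq_s14, LExp_eq_s14, ← hε, binomPS_add_one, map_mul, mul_mul_mul_comm,
    HahnSeries.single_mul_single, ySign_add_one, neg_add]

/-- `±y + c` as a unit. -/
def yUnit {n : ℕ} (σ : Bool) (c : R n) : (Lau n)ˣ :=
  Units.mkOfMulEqOne (yLau n σ + HahnSeries.C c) (LExp σ c (-1)) <| by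
    rw [mul_comm, ← LExp_add_one, neg_add_cancel, LExp_zero]

lemma LExp_eq_zpow {n : ℕ} (σ : Bool) (c : R n) (m : ℤ) :
    LExp σ c m = ((yUnit σ c ^ m : (Lau n)ˣ) : Lau n) := by
  have hstep : ∀ k, LExp σ c (k + 1) = LExp σ c k * (yUnit σ c : Lau n) := LExp_add_one σ c
  induction m using Int.induction_on with
  | zero => rw [LExp_zero, zpow_zero, Units.val_one]
  | succ k ih => rw [hstep, ih, zpow_add_one, Units.val_mul]
  | pred k ih =>
    have h := hstep (-(k : ℤ) - 1)
    rw [sub_add_cancel, ih] at h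
    rw [zpow_sub_one, Units.val_mul, h, Units.mul_inv_cancel_right]

lemma LExp_natCast {n : ℕ} (σ : Bool) (c : R n) (m : ℕ) :
    LExp σ c m = (yLau n σ + HahnSeries.C c) ^ m := by
  rw [LExp_eq_zpow, zpow_natCast, Units.val_pow_eq_pow_val]
  rfl

theorem FExp_zero {n : ℕ} (σ : Bool) (I : Finset (Fin n)) :
    FExp σ 0 I = LExp σ (∑ i ∈ I, X i) ((I.card : ℤ) - 2) := by
  rw [FExp]
  split_ifs with h0 h1
  · obtain rfl := Finset.card_eq_zero.mp h0.2
    have hs : (ySign σ (-2) : R n) = 1 := by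
      rw [ySign]
      split_ifs with _ h
      · rfl
      · rfl
      · exact absurd (by decide) h
    have hb : binomPS (0 : R n) (-2) = 1 := by
      ext1 k
      rw [binomPS, PowerSeries.coeff_mk, PowerSeries.coeff_one]
      split_ifs with h
      · simp [h, binomZ_zero_right]
      · simp [h]
    rw [Finset.card_empty, Nat.cast_zero, zero_sub, LExp_eq_s14, Finset.sum_empty, mul_zero, hb,
      map_one (HahnSeries.ofPowerSeries ℤ (R n)), mul_one, hs, neg_neg]
  · rw [h1.2]
    norm_num
  · have h2 : 2 ≤ I.card := by
      simp only [true_and] at h0 h1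
      omega
    rw [polyOf_Fnpt_zero _ (by omega), eval₂_pow, eval₂_sum,
      show ((I.card : ℤ) - 2) = ((I.card + 1 - 3 : ℕ) : ℤ) by omega, LExp_natCast,
      Fin.sum_univ_succ]
    congr 2
    · rw [eval₂_X, Fin.cons_zero]
    · rw [map_sum, ← sum_orderIsoOfFin I fun i => (HahnSeries.C (X i : R n) : Lau n)]
      refine Finset.sum_congr rfl fun j _ => ?_
      rw [eval₂_X, Fin.cons_succ]

/-! ### Coefficients of products of powers of `y + c` and `−y + c'` -/

lemma LExp_mul_LExp {n : ℕ} (c c' : R n) (m m' : ℤ) :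
    LExp true c m * LExp false c' m' = HahnSeries.single (-(m + m')) (ySign false m') *
      HahnSeries.ofPowerSeries ℤ (R n) (binomPS c m * binomPS (-c') m') := by
  rw [LExp_eq_s14, LExp_eq_s14, mul_mul_mul_comm, HahnSeries.single_mul_single, ← map_mul,
    neg_add]
  simp [ySign]

lemma coeff_LExp_mul_LExp {n : ℕ} (c c' : R n) {m m' j : ℤ} {d : ℕ} (h : j + m + m' = d) :
    (LExp true c m * LExp false c' m').coeff j = ySign false m' *
      ∑ p ∈ Finset.HasAntidiagonal.antidiagonal d, (MvPolynomial.C (binomZ m p.1) * c ^ p.1) *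
        (MvPolynomial.C (binomZ m' p.2) * (-c') ^ p.2) := by
  rw [LExp_mul_LExp, show j = (d : ℤ) + -(m + m') by omega, HahnSeries.coeff_single_mul_add,
    HahnSeries.ofPowerSeries_apply_coeff, PowerSeries.coeff_mul]
  simp only [binomPS, PowerSeries.coeff_mk]

lemma coeff_LExp_mul_LExp_of_neg {n : ℕ} (c c' : R n) {m m' j : ℤ} (h : j + m + m' < 0) :
    (LExp true c m * LExp false c' m').coeff j = 0 := by
  rw [LExp_mul_LExp, show j = (j + m + m') + -(m + m') by ring, HahnSeries.coeff_single_mul_add]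
  have := PowerSeries.coeff_coe (binomPS c m * binomPS (-c') m') (j + m + m')
  rw [this, if_pos h, mul_zero]

lemma totalDegree_coeff_LExp_mul_LExp_le {n : ℕ} {c c' : R n} (hc : c.totalDegree ≤ 1)
    (hc' : c'.totalDegree ≤ 1) {m m' j : ℤ} {d : ℕ} (h : j + m + m' ≤ d) :
    ((LExp true c m * LExp false c' m').coeff j).totalDegree ≤ d := by
  rcases lt_or_ge (j + m + m') 0 with h0 | h0
  · rw [coeff_LExp_mul_LExp_of_neg c c' h0]
    simp
  obtain ⟨e, he⟩ := Int.eq_ofNat_of_zero_le h0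
  rw [coeff_LExp_mul_LExp c c' he]
  have hs : (ySign false m' : R n).totalDegree = 0 := by
    rw [ySign]
    split_ifs <;> simp [totalDegree_neg]
  refine (totalDegree_mul _ _).trans ?_
  rw [hs, zero_add]
  refine (totalDegree_finsetSum _ _).trans (Finset.sup_le fun p hp => ?_)
  rw [Finset.HasAntidiagonal.mem_antidiagonal] at hp
  have aux : ∀ (x : R n) (r : ℚ) (k : ℕ), x.totalDegree ≤ 1 →
      (MvPolynomial.C r * x ^ k).totalDegree ≤ k := by
    intro x r k hx
    refine (totalDegree_mul _ _).trans ?_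
    rw [totalDegree_C, zero_add]
    exact (totalDegree_pow _ _).trans (by simpa using Nat.mul_le_mul_left k hx)
  have h1 := aux c (binomZ m p.1) p.1 hc
  have h2 := aux (-c') (binomZ m' p.2) p.2 (by rwa [totalDegree_neg])
  have h3 := totalDegree_mul (MvPolynomial.C (binomZ m p.1) * c ^ p.1)
    (MvPolynomial.C (binomZ m' p.2) * (-c') ^ p.2)
  omega

lemma map_coeff_LExp_mul_LExp {n : ℕ} (φ : R n →ₐ[ℚ] R n) (c c' : R n) (m m' j : ℤ) :
    φ ((LExp true c m * LExp false c' m').coeff j)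
      = (LExp true (φ c) m * LExp false (φ c') m').coeff j := by
  rcases lt_or_ge (j + m + m') 0 with h0 | h0
  · rw [coeff_LExp_mul_LExp_of_neg c c' h0, coeff_LExp_mul_LExp_of_neg _ _ h0, map_zero]
  obtain ⟨e, he⟩ := Int.eq_ofNat_of_zero_le h0
  have hs : φ (ySign false m') = ySign false m' := by
    rw [ySign]
    split_ifs <;> simp
  have hC : ∀ r : ℚ, φ (MvPolynomial.C r) = MvPolynomial.C r := φ.commutes
  rw [coeff_LExp_mul_LExp c c' he, coeff_LExp_mul_LExp _ _ he, map_mul, hs, map_sum]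
  simp only [map_mul, map_pow, map_neg, hC]

/-! ### Vanishing of the top coefficients -/

/-- The genus zero sum over splittings of the variables indexed by `S`. -/
def splitSum {n : ℕ} (a b : ℤ) (S : Finset (Fin n)) : Lau n :=
  ∑ I ∈ S.powerset, LExp true (∑ i ∈ I, X i) ((I.card : ℤ) - 2 + a) *
    LExp false (∑ i ∈ S \ I, X i) (((S \ I).card : ℤ) - 2 + b)

lemma yLau_add_yLau {n : ℕ} (c c' : R n) :
    (yLau n true + HahnSeries.C c) + (yLau n false + HahnSeries.C c')
      = HahnSeries.C (c + c') := by
  rw [map_add, yLau, yLau, if_pos rfl, if_neg (by simp)]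
  ring

lemma setZero_coeff_splitSum_insert {n : ℕ} (a b : ℤ) {i : Fin n} {T : Finset (Fin n)}
    (hi : i ∉ T) (j : ℤ) :
    setZero i ((splitSum a b (insert i T)).coeff j)
      = (∑ l ∈ T, X l) * (splitSum a b T).coeff j := by
  have key : ∀ I ∈ T.powerset,
      setZero i ((LExp true (∑ l ∈ I, X l) ((I.card : ℤ) - 2 + a) *
        LExp false (∑ l ∈ insert i T \ I, X l)
          (((insert i T \ I).card : ℤ) - 2 + b)).coeff j) +
      setZero i ((LExp true (∑ l ∈ insert i I, X l) (((insert i I).card : ℤ) - 2 + a) *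
        LExp false (∑ l ∈ insert i T \ insert i I, X l)
          (((insert i T \ insert i I).card : ℤ) - 2 + b)).coeff j)
      = (∑ l ∈ T, X l) * (LExp true (∑ l ∈ I, X l) ((I.card : ℤ) - 2 + a) *
        LExp false (∑ l ∈ T \ I, X l) (((T \ I).card : ℤ) - 2 + b)).coeff j := by
    intro I hI
    rw [Finset.mem_powerset] at hI
    have hiI : i ∉ I := fun h => hi (hI h)
    have hiJ : i ∉ T \ I := fun h => hi (Finset.sdiff_subset h)
    rw [Finset.insert_sdiff_insert, Finset.sdiff_insert_of_notMem hi,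
      Finset.insert_sdiff_of_notMem _ hiI, Finset.card_insert_of_notMem hiI,
      Finset.card_insert_of_notMem hiJ, map_coeff_LExp_mul_LExp, map_coeff_LExp_mul_LExp,
      setZero_sum_X hiI, setZero_sum_X hiJ, setZero_sum_X_insert hiI, setZero_sum_X_insert hiJ,
      ← HahnSeries.coeff_add, ← HahnSeries.coeff_single_zero_mul, ← HahnSeries.C_apply, ← sum_X_add_sum_sdiff_X hI,
      ← yLau_add_yLau]
    congr 1
    rw [show (((I.card + 1 : ℕ) : ℤ) - 2 + a) = ((I.card : ℤ) - 2 + a) + 1 by push_cast; ring,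
      show ((((T \ I).card + 1 : ℕ) : ℤ) - 2 + b) = (((T \ I).card : ℤ) - 2 + b) + 1 by
        push_cast; ring, LExp_add_one, LExp_add_one]
    ring
  rw [splitSum, splitSum, Finset.sum_powerset_insert hi, ← Finset.sum_add_distrib,
    HahnSeries.coeff_sum, HahnSeries.coeff_sum, map_sum, Finset.mul_sum]
  refine Finset.sum_congr rfl fun I hI => ?_
  rw [HahnSeries.coeff_add, map_add]
  exact key I hI

theorem coeff_splitSum_eq_zero {n : ℕ} (a b : ℤ) (S : Finset (Fin n)) {j : ℤ}
    (hj : j + a + b ≤ 3) :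
    (splitSum a b S).coeff j = 0 := by
  induction hc : S.card generalizing S with
  | zero =>
    obtain rfl := Finset.card_eq_zero.mp hc
    rw [splitSum, Finset.powerset_empty, Finset.sum_singleton]
    refine coeff_LExp_mul_LExp_of_neg _ _ ?_
    rw [Finset.empty_sdiff, Finset.card_empty]
    omega
  | succ c ih =>
    refine eq_of_setZero_eq (S := S) ?_ (by simp [hc]) fun i hi => ?_
    · rw [splitSum, HahnSeries.coeff_sum, hc, Nat.lt_succ_iff]
      refine (totalDegree_finsetSum _ _).trans (Finset.sup_le fun I hI => ?_)
      rw [Finset.mem_powerset] at hI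
      have h := Finset.card_sdiff_add_card_eq_card hI
      exact totalDegree_coeff_LExp_mul_LExp_le (totalDegree_sum_X_le _) (totalDegree_sum_X_le _)
        (by omega)
    · obtain ⟨T, hiT, rfl⟩ : ∃ T, i ∉ T ∧ insert i T = S :=
        ⟨S.erase i, Finset.notMem_erase i S, Finset.insert_erase hi⟩
      rw [Finset.card_insert_of_notMem hiT, Nat.add_right_cancel_iff] at hc
      rw [setZero_coeff_splitSum_insert a b hiT, ih T hc, mul_zero, map_zero]


/-- Lemma 4.3 (i): in genus 0,
`L_0^{a,b}(y,x) = Σ_{I⊔J={1,…,n}} (y+Σ_I x)^{|I|−2+a} (−y+Σ_J x)^{|J|−2+b}`, and for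
`k ≥ a+b−3`, `[L_0^{a,b}(y,x)]_{y^k} = 0`. -/
theorem lemma_4_3_i (a b : ℤ) (n : ℕ) (hn : 1 ≤ n) :
    (LL 0 n a b
      = ∑ I : Finset (Fin n),
          LExp true (∑ i ∈ I, X i) ((I.card : ℤ) - 2 + a) *
          LExp false (∑ i ∈ Iᶜ, X i) ((Iᶜ.card : ℤ) - 2 + b)) ∧
    (∀ k : ℤ, a + b - 3 ≤ k → ∀ d : Fin n → ℕ, coeffL (LL 0 n a b) k d = 0) := by
  have hLL : LL 0 n a b
      = ∑ I : Finset (Fin n),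
          LExp true (∑ i ∈ I, X i) ((I.card : ℤ) - 2 + a) *
          LExp false (∑ i ∈ Iᶜ, X i) ((Iᶜ.card : ℤ) - 2 + b) := by
    rw [LL, zero_add, Finset.sum_range_one]
    refine Finset.sum_congr rfl fun I _ => ?_
    rw [FExp_zero, Nat.sub_zero, FExp_zero, LExp_add, LExp_add]
    ring
  refine ⟨hLL, fun k hk d => ?_⟩
  have hsplit : LL 0 n a b = splitSum a b univ := by
    rw [hLL, splitSum, Finset.powerset_univ]
    rfl
  rw [coeffL, hsplit, coeff_splitSum_eq_zero a b univ (by omega), coeff_zero]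

end
end
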